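/- arXiv:1807.08091 — 6 statements merged into one kernel-verified Lean document; each statement's English description precedes it below -/
import Mathlib

section
/- Let l : ℝⁿ → ℝ be differentiable and C̃_k-restricted smooth on the nonnegative orthant. Let L, S ⊆ {1,…,n} be disjoint finite sets with |S| ≤ k, let ζ^(L) be an L-maximizer of l and ζ^(L∪S) an (L∪S)-maximizer of l. Then l(ζ^(L∪S)) − l(ζ^(L)) ≥ (1/(2·C̃_k)) · Σ_{j∈S} (max(∇_j l(ζ^(L)), 0))². -/
open Finset

/-- componentwise nonnegativity -/
def Nonneg {n : ℕ} (x : Fin n → ℝ) : Prop := ∀ i, 0 ≤ x i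

/-- the j-th partial derivative of l at x -/
noncomputable def pgrad {n : ℕ} (l : (Fin n → ℝ) → ℝ) (x : Fin n → ℝ) (j : Fin n) : ℝ :=
  fderiv ℝ l x (Pi.single j 1)

/-- `l` is `C`-restricted smooth (RSM) at sparsity level `k` on the nonnegative orthant -/
def RSM {n : ℕ} (l : (Fin n → ℝ) → ℝ) (k : ℕ) (C : ℝ) : Prop :=
  ∀ x y : Fin n → ℝ, Nonneg x → Nonneg y → {i | y i - x i ≠ 0}.ncard ≤ k →
    l y - l x - fderiv ℝ l x (y - x) ≥ -(C / 2) * ∑ i, (y i - x i) ^ 2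

/-- `l` is `c`-restricted strongly concave (RSC) at sparsity level `k`
on the nonnegative orthant -/
def RSC {n : ℕ} (l : (Fin n → ℝ) → ℝ) (k : ℕ) (c : ℝ) : Prop :=
  ∀ x y : Fin n → ℝ, Nonneg x → Nonneg y →
    {i | x i ≠ 0}.ncard ≤ k → {i | y i ≠ 0}.ncard ≤ k →
    l y - l x - fderiv ℝ l x (y - x) ≤ -(c / 2) * ∑ i, (y i - x i) ^ 2

/-- `ζ` is an `L`-maximizer of `l`: nonnegative, supported in `L`, and maximal among
such points -/
def IsMaximizerOn {n : ℕ} (l : (Fin n → ℝ) → ℝ) (L : Finset (Fin n)) (ζ : Fin n → ℝ) : Prop :=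
  Nonneg ζ ∧ (∀ i, ζ i ≠ 0 → i ∈ L) ∧
    ∀ w : Fin n → ℝ, Nonneg w → (∀ i, w i ≠ 0 → i ∈ L) → l w ≤ l ζ

/-- Lemma 5.1: lower bound from restricted smoothness. -/
theorem rsm_lower_bound {n k : ℕ} (l : (Fin n → ℝ) → ℝ) (hl : Differentiable ℝ l)
    (Ck : ℝ) (hCk : 0 < Ck) (hRSM : RSM l k Ck)
    (L S : Finset (Fin n)) (hdisj : Disjoint L S) (hScard : S.card ≤ k)
    (ζL ζLS : Fin n → ℝ)
    (hζL : IsMaximizerOn l L ζL) (hζLS : IsMaximizerOn l (L ∪ S) ζLS) :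
    l ζLS - l ζL ≥ (1 / (2 * Ck)) * ∑ j ∈ S, (max (pgrad l ζL j) 0) ^ 2 := by
  obtain ⟨hζ_nonneg, hζ_supp, -⟩ := hζL
  set g : Fin n → ℝ := fun j => max (pgrad l ζL j) 0 with hg
  set d : Fin n → ℝ := fun i => if i ∈ S then g i / Ck else 0 with hd
  have hd_nonneg : ∀ i, 0 ≤ d i := fun i => by
    simp only [hd]
    split_ifs
    · exact div_nonneg (le_max_right _ _) hCk.le
    · exact le_rfl
  have hd_mem : ∀ i, d i ≠ 0 → i ∈ S := fun i hi => by
    by_contra h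
    exact hi (if_neg h)
  have hy_nonneg : Nonneg (ζL + d) := fun i => add_nonneg (hζ_nonneg i) (hd_nonneg i)
  have hy_supp : ∀ i, (ζL + d) i ≠ 0 → i ∈ L ∪ S := fun i hi => by
    by_contra h
    rw [Finset.mem_union, not_or] at h
    refine hi ?_
    rw [Pi.add_apply, not_not.mp (mt (hζ_supp i) h.1), not_not.mp (mt (hd_mem i) h.2), add_zero]
  have hcard : {i | (ζL + d) i - ζL i ≠ 0}.ncard ≤ k := by
    refine le_trans ?_ hScard
    rw [← Set.ncard_coe_finset S]
    refine Set.ncard_le_ncard (fun i hi => hd_mem i ?_) S.finite_toSet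
    simpa using hi
  have hsmooth := hRSM ζL (ζL + d) hζ_nonneg hy_nonneg hcard
  have hmax := hζLS.2.2 (ζL + d) hy_nonneg hy_supp
  have hlin : fderiv ℝ l ζL d = (1 / Ck) * ∑ j ∈ S, g j ^ 2 := by
    have hg_sq : ∀ j, g j * pgrad l ζL j = g j ^ 2 := fun j => by
      simp only [hg]
      rcases le_total (pgrad l ζL j) 0 with h | h
      · simp [max_eq_right h]
      · rw [max_eq_left h, sq]
    have hsum : fderiv ℝ l ζL d = ∑ i, d i * pgrad l ζL i := by
      conv_lhs => rw [pi_eq_sum_univ' d]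
      simp [pgrad]
    rw [hsum, Finset.mul_sum]
    simp only [hd, ite_mul, zero_mul, Finset.sum_ite_mem, Finset.univ_inter]
    refine Finset.sum_congr rfl fun j _ => ?_
    rw [← hg_sq]
    ring
  have hquad : ∑ i, ((ζL + d) i - ζL i) ^ 2 = (1 / Ck ^ 2) * ∑ j ∈ S, g j ^ 2 := by
    simp only [Pi.add_apply, add_sub_cancel_left, hd, ite_pow, ne_eq, OfNat.ofNat_ne_zero,
      not_false_eq_true, zero_pow, Finset.sum_ite_mem, Finset.univ_inter]
    rw [Finset.mul_sum]
    refine Finset.sum_congr rfl fun j _ => ?_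
    ring
  rw [add_sub_cancel_left, hlin, hquad] at hsmooth
  have hcoef : (1 / (2 * Ck)) * ∑ j ∈ S, g j ^ 2 =
      (1 / Ck) * ∑ j ∈ S, g j ^ 2 + -(Ck / 2) * ((1 / Ck ^ 2) * ∑ j ∈ S, g j ^ 2) := by
    field_simp
    ring
  rw [hcoef]
  linarith
end

section
/- Let l : ℝⁿ → ℝ be differentiable and c_k-restricted strongly concave on the nonnegative orthant. Let L, S ⊆ {1,…,n} be disjoint finite sets with |L| + |S| ≤ k, let ζ^(L) be an L-maximizer of l and ζ^(L∪S) an (L∪S)-maximizer of l. Then l(ζ^(L∪S)) − l(ζ^(L)) ≤ (1/(2·c_k)) · Σ_{j∈S} (max(∇_j l(ζ^(L)), 0))². -/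
open Finset

/-- The pairing of the derivative with a vector, expanded in partial derivatives. -/
lemma fderiv_apply_eq_sum_pgrad {n : ℕ} (l : (Fin n → ℝ) → ℝ) (x v : Fin n → ℝ) :
    fderiv ℝ l x v = ∑ i, v i * pgrad l x i := by
  conv_lhs => rw [pi_eq_sum_univ' v]
  simp only [map_sum, map_smul, smul_eq_mul, pgrad]

/-- First-order optimality: at an `L`-maximizer, moving within the nonnegative orthant along
a coordinate in `L` does not increase `l` to first order. -/
lemma IsMaximizerOn.mul_pgrad_nonpos {n : ℕ} {l : (Fin n → ℝ) → ℝ} {L : Finset (Fin n)}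
    {ζ : Fin n → ℝ} (h : IsMaximizerOn l L ζ) (hl : DifferentiableAt ℝ l ζ)
    {i : Fin n} (hi : i ∈ L) {a : ℝ} (ha : 0 ≤ a) : (a - ζ i) * pgrad l ζ i ≤ 0 := by
  obtain ⟨hnonneg, hsupp, hmax⟩ := h
  let s : Set (Fin n → ℝ) := {w | Nonneg w ∧ ∀ j, w j ≠ 0 → j ∈ L}
  have hs : Convex ℝ s := by
    rintro x ⟨hx, hxL⟩ y ⟨hy, hyL⟩ p q hp hq _
    refine ⟨fun j => add_nonneg (mul_nonneg hp (hx j)) (mul_nonneg hq (hy j)), fun j hj => ?_⟩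
    by_contra hjL
    have hxj : x j = 0 := by_contra fun hne => hjL (hxL j hne)
    have hyj : y j = 0 := by_contra fun hne => hjL (hyL j hne)
    simp [hxj, hyj] at hj
  have hζ : ζ ∈ s := ⟨hnonneg, hsupp⟩
  have hw : Function.update ζ i a ∈ s := by
    refine ⟨fun j => ?_, fun j hj => ?_⟩ <;> rcases eq_or_ne j i with rfl | hne
    · simpa using ha
    · simpa [hne] using hnonneg j
    · exact hi
    · exact hsupp j (by simpa [hne] using hj)
  have hloc : IsLocalMaxOn l s ζ :=
    IsMaxOn.localize fun w hws => hmax w hws.1 hws.2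
  have hle := hloc.hasFDerivWithinAt_nonpos hl.hasFDerivAt.hasFDerivWithinAt
    (sub_mem_posTangentConeAt_of_segment_subset (hs.segment_subset hζ hw))
  have hdiff : Function.update ζ i a - ζ = (a - ζ i) • Pi.single i (1 : ℝ) := by
    ext j
    rcases eq_or_ne j i with rfl | hne <;> simp [*]
  simpa [hdiff, pgrad] using hle

/-- A point supported in `T` has at most `#T` nonzero coordinates. -/
lemma ncard_support_le {n k : ℕ} {T : Finset (Fin n)} {x : Fin n → ℝ}
    (hx : ∀ i, x i ≠ 0 → i ∈ T) (hT : T.card ≤ k) : {i | x i ≠ 0}.ncard ≤ k := by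
  refine le_trans ?_ hT
  rw [← Set.ncard_coe_finset T]
  exact Set.ncard_le_ncard hx T.finite_toSet

/-- Scalar quadratic bound over the nonnegative half-line. -/
lemma mul_sub_sq_le_max_sq {c t : ℝ} (hc : 0 < c) (ht : 0 ≤ t) (g : ℝ) :
    t * g - c / 2 * t ^ 2 ≤ 1 / (2 * c) * max g 0 ^ 2 := by
  have hg : t * g ≤ t * max g 0 := mul_le_mul_of_nonneg_left (le_max_left g 0) ht
  have hsq : 1 / (2 * c) * max g 0 ^ 2 - (t * max g 0 - c / 2 * t ^ 2)
      = 1 / (2 * c) * (max g 0 - c * t) ^ 2 := by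
    field_simp
    ring
  have : 0 ≤ 1 / (2 * c) * (max g 0 - c * t) ^ 2 := by positivity
  linarith

/-- Lemma 5.2: upper bound from restricted strong concavity. -/
theorem rsc_upper_bound {n k : ℕ} (l : (Fin n → ℝ) → ℝ) (hl : Differentiable ℝ l)
    (ck : ℝ) (hck : 0 < ck) (hRSC : RSC l k ck)
    (L S : Finset (Fin n)) (hdisj : Disjoint L S) (hcard : L.card + S.card ≤ k)
    (ζL ζLS : Fin n → ℝ)
    (hζL : IsMaximizerOn l L ζL) (hζLS : IsMaximizerOn l (L ∪ S) ζLS) :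
    l ζLS - l ζL ≤ (1 / (2 * ck)) * ∑ j ∈ S, (max (pgrad l ζL j) 0) ^ 2 := by
  obtain ⟨hx, hxL, -⟩ := id hζL
  obtain ⟨hy, hyLS, -⟩ := hζLS
  have hrsc := hRSC ζL ζLS hx hy (ncard_support_le hxL (by omega))
    (ncard_support_le hyLS ((card_union_le L S).trans hcard))
  rw [fderiv_apply_eq_sum_pgrad] at hrsc
  have hbound : ∑ i, ((ζLS - ζL) i * pgrad l ζL i - ck / 2 * (ζLS i - ζL i) ^ 2)
      ≤ ∑ i, if i ∈ S then 1 / (2 * ck) * max (pgrad l ζL i) 0 ^ 2 else 0 := by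
    refine Finset.sum_le_sum fun i _ => ?_
    rw [Pi.sub_apply]
    split_ifs with hiS
    · have hxi : ζL i = 0 := by_contra fun hne => disjoint_left.mp hdisj (hxL i hne) hiS
      simpa [hxi] using mul_sub_sq_le_max_sq hck (hy i) (pgrad l ζL i)
    · by_cases hiL : i ∈ L
      · have hopt := hζL.mul_pgrad_nonpos (hl ζL) hiL (hy i)
        have : 0 ≤ ck / 2 * (ζLS i - ζL i) ^ 2 := by positivity
        linarith
      · have hxi : ζL i = 0 := by_contra fun hne => hiL (hxL i hne)
        have hyi : ζLS i = 0 := by_contra fun hne => by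
          simpa [hiL, hiS] using hyLS i hne
        simp [hxi, hyi]
  rw [Finset.sum_sub_distrib, ← Finset.mul_sum, Finset.sum_ite_mem, univ_inter,
    ← Finset.mul_sum] at hbound
  linarith
end

section
/- Let f : Finset({1,…,n}) → ℝ be a monotone set function (L₁ ⊆ L₂ implies f(L₁) ≤ f(L₂)) with f(∅) = 0, let m ≥ 1 and let r_m, R_m > 0 be constants such that for every set Z with |Z| = m one has r_m · f(Z) ≤ Σ_{j∈Z} f({j}) ≤ R_m · f(Z). Let S be a set with |S| = m such that f({j}) ≥ f({p}) for every j ∈ S and every p ∉ S. Then for every set T with |T| = m, f(S) ≥ (r_m / R_m) · f(T). -/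
open Finset

/-- Among sets of a given size, one that dominates its complement pointwise has the largest sum. -/
theorem Finset.sum_le_sum_of_card_eq_of_forall_notMem_le {ι : Type*} [DecidableEq ι] {g : ι → ℝ}
    {S T : Finset ι} (hcard : T.card = S.card) (htop : ∀ j ∈ S, ∀ p ∉ S, g p ≤ g j) :
    ∑ j ∈ T, g j ≤ ∑ j ∈ S, g j := by
  rw [← Finset.sum_sdiff_le_sum_sdiff]
  have hsdiff : (T \ S).card = (S \ T).card := Finset.card_sdiff_comm hcard
  rcases (S \ T).eq_empty_or_nonempty with h | h
  · have hT : T \ S = ∅ := by rw [← Finset.card_eq_zero, hsdiff, h, Finset.card_empty]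
    simp [h, hT]
  · obtain ⟨c, hc, hmin⟩ := Finset.exists_min_image (S \ T) g h
    calc ∑ j ∈ T \ S, g j ≤ (T \ S).card • g c :=
          Finset.sum_le_card_nsmul _ _ _ fun p hp =>
            htop c (Finset.mem_sdiff.mp hc).1 p (Finset.mem_sdiff.mp hp).2
      _ = (S \ T).card • g c := by rw [hsdiff]
      _ ≤ ∑ j ∈ S \ T, g j := Finset.card_nsmul_le_sum _ _ _ hmin

/-- Theorem 5.5: constant factor guarantee for monotone set functions with
submodularity ratio bounded from above and below. -/
theorem constant_factor_bounded_gamma {n m : ℕ} (hm : 1 ≤ m) (hmn : m ≤ n)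
    (f : Finset (Fin n) → ℝ)
    (hmono : ∀ L₁ L₂ : Finset (Fin n), L₁ ⊆ L₂ → f L₁ ≤ f L₂)
    (hempty : f ∅ = 0)
    (rm Rm : ℝ) (hrm : 0 < rm) (hRm : 0 < Rm)
    (hbound : ∀ Z : Finset (Fin n), Z.card = m →
      rm * f Z ≤ ∑ j ∈ Z, f {j} ∧ ∑ j ∈ Z, f {j} ≤ Rm * f Z)
    (S : Finset (Fin n)) (hScard : S.card = m)
    (htop : ∀ j ∈ S, ∀ p ∉ S, f {p} ≤ f {j}) :
    ∀ T : Finset (Fin n), T.card = m → f S ≥ (rm / Rm) * f T := by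
  intro T hT
  have hsum : ∑ j ∈ T, f {j} ≤ ∑ j ∈ S, f {j} :=
    Finset.sum_le_sum_of_card_eq_of_forall_notMem_le (hT.trans hScard.symm) htop
  rw [ge_iff_le, div_mul_eq_mul_div, div_le_iff₀' hRm]
  exact (hbound T hT).1.trans (hsum.trans (hbound S hScard).2)
end

section
/- Let l : ℝⁿ → ℝ be differentiable and C̃_1-restricted smooth on the nonnegative orthant, let m ≥ 1 and τ > 0, let L ⊆ {1,…,n} be a finite set and j ∉ L, and let ζ^(L) be an L-maximizer of l and ζ^(L∪{j}) an (L∪{j})-maximizer of l. If ∇_j l(ζ^(L)) ≥ √(2τ/m), then l(ζ^(L∪{j})) − l(ζ^(L)) ≥ τ/(C̃_1 · m). -/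
open Finset

/-- Along a coordinate direction, restricted smoothness at sparsity level one is the
one-dimensional quadratic lower bound. -/
lemma RSM.add_single_ge {n : ℕ} {l : (Fin n → ℝ) → ℝ} {C : ℝ} (h : RSM l 1 C)
    {x : Fin n → ℝ} (hx : Nonneg x) (j : Fin n) {s : ℝ} (hs : 0 ≤ s) :
    s * pgrad l x j - C / 2 * s ^ 2 ≤ l (x + Pi.single j s) - l x := by
  have hsingle : ∀ i, (x + Pi.single j s : Fin n → ℝ) i - x i = (Pi.single j s : Fin n → ℝ) i := by simp
  have hnonneg : Nonneg (x + Pi.single j s) := fun i =>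
    add_nonneg (hx i) ((Pi.single_nonneg.2 hs : (0 : Fin n → ℝ) ≤ Pi.single j s) i)
  have hcard : {i | (x + Pi.single j s : Fin n → ℝ) i - x i ≠ 0}.ncard ≤ 1 := by
    rw [← Set.ncard_singleton j]
    refine Set.ncard_le_ncard (fun i hi => ?_) (Set.finite_singleton j)
    rw [Set.mem_ofPred_eq, hsingle] at hi
    by_contra hij
    exact hi (by rw [Pi.single_eq_of_ne hij])
  have key := h x _ hx hnonneg hcard
  have hsum : ∑ i, ((x + Pi.single j s : Fin n → ℝ) i - x i) ^ 2 = s ^ 2 := by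
    simp_rw [hsingle]
    rw [Finset.sum_eq_single j (fun i _ hij => by simp [hij]) (by simp), Pi.single_eq_same]
  have hderiv : fderiv ℝ l x (x + Pi.single j s - x) = s * pgrad l x j := by
    have hsmul : (Pi.single j s : Fin n → ℝ) = s • Pi.single j 1 := by
      rw [← Pi.single_smul, smul_eq_mul, mul_one]
    rw [add_sub_cancel_left, hsmul, map_smul, smul_eq_mul, pgrad]
  rw [hsum, hderiv] at key
  linarith

/-- Thresholded single-element gain: if the gradient coordinate exceeds √(2τ/m),
adding that element increases the objective by at least τ/(C̃₁·m). -/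
theorem threshold_single_gain {n m : ℕ} (l : (Fin n → ℝ) → ℝ)
    (hl : Differentiable ℝ l)
    (C1 : ℝ) (hC1 : 0 < C1) (hRSM : RSM l 1 C1)
    (hm : 1 ≤ m) (τ : ℝ) (hτ : 0 < τ)
    (L : Finset (Fin n)) (j : Fin n) (hj : j ∉ L)
    (ζL ζLj : Fin n → ℝ)
    (hζL : IsMaximizerOn l L ζL) (hζLj : IsMaximizerOn l (L ∪ {j}) ζLj)
    (hgrad : pgrad l ζL j ≥ Real.sqrt (2 * τ / m)) :
    l ζLj - l ζL ≥ τ / (C1 * m) := by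
  have hg : 0 ≤ pgrad l ζL j := (Real.sqrt_nonneg _).trans hgrad
  have hsq : 2 * τ / m ≤ pgrad l ζL j ^ 2 := (Real.sqrt_le_left hg).1 hgrad
  obtain ⟨hnonneg, hsupp, -⟩ := hζL
  have hs : 0 ≤ pgrad l ζL j / C1 := div_nonneg hg hC1.le
  have hgain := hRSM.add_single_ge hnonneg j hs
  have hmax : l (ζL + Pi.single j (pgrad l ζL j / C1)) ≤ l ζLj := by
    refine hζLj.2.2 _ (fun i => add_nonneg (hnonneg i)
      ((Pi.single_nonneg.2 hs : (0 : Fin n → ℝ) ≤ Pi.single j _) i)) (fun i hi => ?_)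
    rw [Finset.mem_union, Finset.mem_singleton]
    by_contra! hij
    refine hi ?_
    rw [Pi.add_apply, Pi.single_eq_of_ne hij.2, add_zero]
    by_contra hne
    exact hij.1 (hsupp i hne)
  have hopt : pgrad l ζL j / C1 * pgrad l ζL j - C1 / 2 * (pgrad l ζL j / C1) ^ 2 =
      pgrad l ζL j ^ 2 / (2 * C1) := by
    field_simp
    ring
  have hbound : τ / (C1 * m) ≤ pgrad l ζL j ^ 2 / (2 * C1) :=
    calc τ / (C1 * m) = 2 * τ / m / (2 * C1) := by field_simp
      _ ≤ _ := by gcongr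
  linarith
end

section
/- Let l : ℝⁿ → ℝ be differentiable with l(0) = 0 and C̃_1-restricted smooth on the nonnegative orthant, let m ≥ 1 and τ > 0, and assume an L-maximizer ζ^(L) of l exists for every finite L (write f(L) = l(ζ^(L))). Suppose L_τ = {j_1, …, j_m} is a set of m distinct indices such that, writing L_0 = ∅ and L_i = {j_1, …, j_i}, one has ∇_{j_i} l(ζ^(L_{i−1})) ≥ √(2τ/m) for every i ∈ {1,…,m}. Then f(L_τ) ≥ τ / C̃_1. -/
open Finset

/-- Restricted smoothness at sparsity level one bounds `l` from below along a coordinate ray. -/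
lemma RSM.le_apply_add_single {n : ℕ} {l : (Fin n → ℝ) → ℝ} {C : ℝ} (h : RSM l 1 C)
    {x : Fin n → ℝ} (hx : Nonneg x) (j : Fin n) {t : ℝ} (ht : 0 ≤ t) :
    l x + t * pgrad l x j - C / 2 * t ^ 2 ≤ l (x + Pi.single j t) := by
  have hy : Nonneg (x + Pi.single j t) := fun i =>
    add_nonneg (hx i) ((Pi.single_nonneg.mpr ht : (0 : Fin n → ℝ) ≤ Pi.single j t) i)
  have hcard : {i | (x + Pi.single j t : Fin n → ℝ) i - x i ≠ 0}.ncard ≤ 1 := by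
    refine (Set.ncard_le_ncard (t := {j}) fun i hi => ?_).trans (Set.ncard_singleton j).le
    by_contra hij
    have hij' : i ≠ j := hij
    simp [hij'] at hi
  have hsum : ∑ i, ((x + Pi.single j t : Fin n → ℝ) i - x i) ^ 2 = t ^ 2 := by
    simp [Pi.single_apply, ite_pow]
  have hderiv : fderiv ℝ l x (Pi.single j t) = t * pgrad l x j := by
    have hsingle : (Pi.single j t : Fin n → ℝ) = t • Pi.single j 1 := by
      rw [← Pi.single_smul, smul_eq_mul, mul_one]
    rw [hsingle, map_smul, smul_eq_mul, pgrad]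
  have key := h x _ hx hy hcard
  rw [hsum, add_sub_cancel_left, hderiv] at key
  linarith

/-- Adding to the support a coordinate whose partial derivative is at least `s` raises the
maximum by at least `s ^ 2 / (2 * C)`. -/
lemma IsMaximizerOn.add_sq_div_le {n : ℕ} {l : (Fin n → ℝ) → ℝ} {C : ℝ} (hC : 0 < C)
    (h : RSM l 1 C) {L : Finset (Fin n)} {j : Fin n} {x z : Fin n → ℝ}
    (hx : IsMaximizerOn l L x) (hz : IsMaximizerOn l (insert j L) z)
    {s : ℝ} (hs : 0 ≤ s) (hj : s ≤ pgrad l x j) :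
    l x + s ^ 2 / (2 * C) ≤ l z := by
  have ht : 0 ≤ s / C := by positivity
  have hray := h.le_apply_add_single hx.1 j ht
  have hmax : l (x + Pi.single j (s / C)) ≤ l z := by
    refine hz.2.2 _ (fun i => add_nonneg (hx.1 i)
      ((Pi.single_nonneg.mpr ht : (0 : Fin n → ℝ) ≤ Pi.single j (s / C)) i)) fun i hi => ?_
    rw [mem_insert]
    by_contra! hnot
    refine hi ?_
    have hxi : x i = 0 := by_contra fun h0 => hnot.2 (hx.2.1 i h0)
    simp [hxi, hnot.1]
  have hgain : s / C * s ≤ s / C * pgrad l x j := mul_le_mul_of_nonneg_left hj ht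
  have hsq : s / C * s - C / 2 * (s / C) ^ 2 = s ^ 2 / (2 * C) := by
    field_simp
    ring
  linarith

/-- Lemma 5.6: if the set `L_τ` for threshold `τ` was filled to cardinality `m`
(each element passing the gradient threshold √(2τ/m) when it was added),
then `f(L_τ) ≥ τ/C̃₁`. -/
theorem threshold_set_value {n m : ℕ} (l : (Fin n → ℝ) → ℝ)
    (hl : Differentiable ℝ l) (hl0 : l 0 = 0)
    (C1 : ℝ) (hC1 : 0 < C1) (hRSM : RSM l 1 C1)
    (hm : 1 ≤ m) (τ : ℝ) (hτ : 0 < τ)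
    (ζ : Finset (Fin n) → (Fin n → ℝ)) (hζ : ∀ L, IsMaximizerOn l L (ζ L))
    (js : Fin m → Fin n) (hinj : Function.Injective js)
    (hstep : ∀ i : Fin m,
      pgrad l (ζ ((Finset.univ.filter (· < i)).image js)) (js i) ≥
        Real.sqrt (2 * τ / m)) :
    l (ζ (Finset.univ.image js)) ≥ τ / C1 := by
  have hm0 : (0 : ℝ) < m := by exact_mod_cast hm
  have hgain : Real.sqrt (2 * τ / m) ^ 2 / (2 * C1) = τ / (m * C1) := by
    rw [Real.sq_sqrt (by positivity)]
    field_simp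
  have hprefix : ∀ k : ℕ, k ≤ m →
      k * (τ / (m * C1)) ≤ l (ζ ((univ.filter fun i : Fin m => i.val < k).image js)) := by
    intro k
    induction k with
    | zero =>
      intro _
      simpa [hl0] using (hζ (image js (univ.filter fun i : Fin m => i.val < 0))).2.2 0
        (fun _ => le_rfl) (by simp)
    | succ k ih =>
      intro hk
      have hinsert : (univ.filter fun i : Fin m => i.val < k + 1).image js =
          insert (js ⟨k, hk⟩) ((univ.filter fun i : Fin m => i.val < k).image js) := by
        rw [← image_insert]
        congr 1
        ext i
        simp only [mem_filter, mem_univ, true_and, mem_insert, Fin.ext_iff]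
        omega
      have hgrow := IsMaximizerOn.add_sq_div_le hC1 hRSM (hζ _) (hζ _)
        (Real.sqrt_nonneg _) (hstep ⟨k, hk⟩)
      rw [hgain] at hgrow
      have hprev := ih (by omega)
      simp only [Fin.lt_def] at hgrow
      rw [hinsert]
      push_cast
      linarith
  have hfull := hprefix m le_rfl
  have htotal : m * (τ / (m * C1)) = τ / C1 := by field_simp
  simpa [htotal] using hfull
end

section
/- Let l : ℝⁿ → ℝ be differentiable with l(0) = 0 and C̃_1-restricted smooth on the nonnegative orthant, let m ≥ 1, τ > 0, c_m > 0, and assume an L-maximizer ζ^(L) of l exists for every finite L (write f(L) = l(ζ^(L))). Suppose L_τ = {j_1, …, j_m} consists of m distinct indices such that, writing L_0 = ∅ and L_i = {j_1, …, j_i}, one has ∇_{j_i} l(ζ^(L_{i−1})) ≥ √(2τ/m) for every i ∈ {1,…,m}, and suppose T ⊆ {1,…,n} is a set with τ ≥ c_m · f(T). Then f(L_τ) ≥ (c_m / C̃_1) · f(T). -/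
open Finset

/-- Adding a coordinate whose partial derivative at the `L`-maximizer is at least `s` raises the
maximum by at least `s ^ 2 / (2 * C)`. -/
theorem RSM.add_le_of_le_pgrad {n : ℕ} {l : (Fin n → ℝ) → ℝ} {C s : ℝ} (h : RSM l 1 C)
    (hC : 0 < C) (hs : 0 ≤ s) {L : Finset (Fin n)} {j : Fin n} {x z : Fin n → ℝ}
    (hx : IsMaximizerOn l L x) (hz : IsMaximizerOn l (insert j L) z) (hg : s ≤ pgrad l x j) :
    l x + s ^ 2 / (2 * C) ≤ l z := by
  obtain ⟨hx0, hxL, -⟩ := hx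
  have ht : 0 ≤ s / C := by positivity
  set y : Fin n → ℝ := x + (s / C) • Pi.single j 1 with hy
  have hyx : y - x = (s / C) • Pi.single j 1 := by simp [hy]
  have hcoord (i : Fin n) : y i - x i = if i = j then s / C else 0 := by
    simp [hy, Pi.single_apply]
  have hy0 : Nonneg y := fun i ↦ by
    have := hcoord i
    have := hx0 i
    split_ifs at * <;> linarith
  have hyL : ∀ i, y i ≠ 0 → i ∈ insert j L := fun i hi ↦ by
    by_cases hij : i = j
    · simp [hij]
    · have := hcoord i
      rw [if_neg hij, sub_eq_zero] at this
      exact mem_insert_of_mem (hxL i (this ▸ hi))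
  have hcard : {i | y i - x i ≠ 0}.ncard ≤ 1 := by
    rw [← Set.ncard_singleton j]
    refine Set.ncard_le_ncard (fun i hi ↦ ?_) (Set.finite_singleton j)
    by_contra hij
    exact hi (by rw [hcoord, if_neg (by simpa using hij)])
  have hsum : ∑ i, (y i - x i) ^ 2 = (s / C) ^ 2 := by
    simp [hcoord]
  have hsm := h x y hx0 hy0 hcard
  rw [hyx, map_smul, smul_eq_mul, hsum] at hsm
  have hlin : s / C * s ≤ s / C * fderiv ℝ l x (Pi.single j 1) :=
    mul_le_mul_of_nonneg_left hg ht
  have hmax := hz.2.2 y hy0 hyL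
  have hval : s / C * s - C / 2 * (s / C) ^ 2 = s ^ 2 / (2 * C) := by
    field_simp
    ring
  linarith

/-- If the threshold `τ` dominates `c_m·f(T)` and the set `L_τ` was filled to
cardinality `m`, then `f(L_τ) ≥ (c_m/C̃₁)·f(T)`. -/
theorem threshold_set_approx {n m : ℕ} (l : (Fin n → ℝ) → ℝ)
    (hl : Differentiable ℝ l) (hl0 : l 0 = 0)
    (C1 : ℝ) (hC1 : 0 < C1) (hRSM : RSM l 1 C1)
    (hm : 1 ≤ m) (τ : ℝ) (hτ : 0 < τ) (cm : ℝ) (hcm : 0 < cm)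
    (ζ : Finset (Fin n) → (Fin n → ℝ)) (hζ : ∀ L, IsMaximizerOn l L (ζ L))
    (js : Fin m → Fin n) (hinj : Function.Injective js)
    (hstep : ∀ i : Fin m,
      pgrad l (ζ ((Finset.univ.filter (· < i)).image js)) (js i) ≥
        Real.sqrt (2 * τ / m))
    (T : Finset (Fin n)) (hT : τ ≥ cm * l (ζ T)) :
    l (ζ (Finset.univ.image js)) ≥ (cm / C1) * l (ζ T) := by
  have hm0 : (0 : ℝ) < m := by exact_mod_cast hm
  have key : ∀ k : ℕ, k ≤ m →
      k * (τ / (m * C1)) ≤ l (ζ ((univ.filter fun i : Fin m ↦ (i : ℕ) < k).image js)) := by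
    intro k
    induction k with
    | zero =>
      intro _
      have := (hζ ((univ.filter fun i : Fin m ↦ (i : ℕ) < 0).image js)).2.2 0
        (fun _ ↦ le_rfl) (by simp)
      simpa [hl0] using this
    | succ k ih =>
      intro hk
      have hset : (univ.filter fun i : Fin m ↦ (i : ℕ) < k + 1).image js =
          insert (js ⟨k, hk⟩) ((univ.filter fun i : Fin m ↦ (i : ℕ) < k).image js) := by
        rw [← image_insert]
        congr 1
        ext i
        simp [Fin.ext_iff]
        omega
      have hgain := hRSM.add_le_of_le_pgrad hC1 (Real.sqrt_nonneg _) (hζ _)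
        (hζ (insert (js ⟨k, hk⟩) _)) (hstep ⟨k, hk⟩)
      rw [Real.sq_sqrt (by positivity)] at hgain
      have hval : 2 * τ / m / (2 * C1) = τ / (m * C1) := by field_simp
      rw [hval] at hgain
      have := ih (by omega)
      rw [hset]
      push_cast
      simp only [Fin.lt_def] at hgain
      linarith
  have hfin := key m le_rfl
  have hval : m * (τ / (m * C1)) = τ / C1 := by field_simp
  simp only [Fin.is_lt, filter_true, hval] at hfin
  calc cm / C1 * l (ζ T) = cm * l (ζ T) / C1 := by ring
    _ ≤ τ / C1 := by gcongr
    _ ≤ _ := hfin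
end
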